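/- arXiv:1304.3009 — 4 statements merged into one kernel-verified Lean document; each statement's English description precedes it below -/
import Mathlib

section
/- Let a₀, …, a_n ∈ ℕ₀ and c₁, …, c_k ∈ ℤ, and assume that there exist polynomials P₁(X), …, P_k(X) ∈ ℤ[X], each u-equivalent to Σ_{i=0}^n a_iX^i, such that c₁P₁(X) + … + c_kP_k(X) = 0 (as a polynomial). Then for every idempotent ultrafilter U on ℕ₀ and every A ∈ a₀U ⊕ a₁U ⊕ … ⊕ a_nU, there exist elements x₁, …, x_k ∈ A such that c₁x₁ + … + c_kx_k = 0. -/
open Ultrafilter Polynomial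

/-- The pseudo-sum `U ⊕ V` of ultrafilters on `ℕ`:
`A ∈ U ⊕ V ↔ {n | {m | n + m ∈ A} ∈ V} ∈ U`. -/
def pseudoSum (U V : Ultrafilter ℕ) : Ultrafilter ℕ :=
  U.bind fun n => V.map fun m => n + m

/-- The product `h U` of an ultrafilter on `ℕ` by a natural number:
`A ∈ h U ↔ {n | n * h ∈ A} ∈ U`. -/
def smulU (h : ℕ) (U : Ultrafilter ℕ) : Ultrafilter ℕ :=
  U.map fun n => n * h

/-- `U` is idempotent: non-principal and `U ⊕ U = U`. -/
def IsIdempotentUF (U : Ultrafilter ℕ) : Prop :=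
  (∀ n : ℕ, U ≠ pure n) ∧ pseudoSum U U = U

/-- The linear combination `d₀ U ⊕ d₁ U ⊕ … ⊕ dₙ U` associated to the string
`⟨d₀, …, dₙ⟩`; the empty string gives the principal ultrafilter at `0`. -/
def oplusU (U : Ultrafilter ℕ) : List ℕ → Ultrafilter ℕ
  | [] => pure 0
  | [d] => smulU d U
  | d :: l => pseudoSum (smulU d U) (oplusU U l)

/-- `u`-equivalence: the smallest equivalence relation on finite strings of
integers containing `ε ≈ᵤ ⟨0⟩`, `⟨a⟩ ≈ᵤ ⟨a,a⟩`, and coherent with concatenation. -/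
inductive UEquiv : List ℤ → List ℤ → Prop where
  | nil_zero : UEquiv [] [0]
  | dup (a : ℤ) : UEquiv [a] [a, a]
  | refl (l : List ℤ) : UEquiv l l
  | symm {l₁ l₂ : List ℤ} : UEquiv l₁ l₂ → UEquiv l₂ l₁
  | trans {l₁ l₂ l₃ : List ℤ} : UEquiv l₁ l₂ → UEquiv l₂ l₃ → UEquiv l₁ l₃
  | append {σ σ' τ τ' : List ℤ} : UEquiv σ σ' → UEquiv τ τ' →
      UEquiv (σ ++ τ) (σ' ++ τ')

/-- The string of coefficients of a polynomial, listed from degree 0 upward. -/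
def coeffString (P : Polynomial ℤ) : List ℤ :=
  (List.range (P.natDegree + 1)).map P.coeff

/-- Two polynomials are `u`-equivalent when their strings of coefficients are. -/
def PolyUEquiv (P Q : Polynomial ℤ) : Prop :=
  UEquiv (coeffString P) (coeffString Q)

theorem mem_pseudoSum {U V : Ultrafilter ℕ} {A : Set ℕ} :
    A ∈ pseudoSum U V ↔ {n | {m | n + m ∈ A} ∈ V} ∈ U := Iff.rfl

theorem mem_smulU {h : ℕ} {U : Ultrafilter ℕ} {A : Set ℕ} :
    A ∈ smulU h U ↔ {n | n * h ∈ A} ∈ U := Iff.rfl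

theorem pseudoSum_assoc (U V W : Ultrafilter ℕ) :
    pseudoSum (pseudoSum U V) W = pseudoSum U (pseudoSum V W) := by
  ext A
  simp only [mem_pseudoSum, Set.mem_ofPred_eq, add_assoc]

theorem pseudoSum_pure_zero (U : Ultrafilter ℕ) : pseudoSum U (pure 0) = U := by
  ext A
  simp [mem_pseudoSum, Ultrafilter.mem_pure]

theorem pure_zero_pseudoSum (U : Ultrafilter ℕ) : pseudoSum (pure 0) U = U := by
  ext A
  simp [mem_pseudoSum, Ultrafilter.mem_pure]

theorem smulU_zero (U : Ultrafilter ℕ) : smulU 0 U = pure 0 := by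
  ext A
  by_cases h : (0 : ℕ) ∈ A
  · have hev : ∀ᶠ n in (U : Filter ℕ), n * 0 ∈ A := .of_forall fun _ => h
    exact iff_of_true hev h
  · simp [mem_smulU, Ultrafilter.mem_pure, h]

theorem smulU_pseudoSum (h : ℕ) (U V : Ultrafilter ℕ) :
    smulU h (pseudoSum U V) = pseudoSum (smulU h U) (smulU h V) := by
  ext A
  simp only [mem_smulU, mem_pseudoSum, Set.mem_ofPred_eq, add_mul]

theorem oplusU_cons (U : Ultrafilter ℕ) (d : ℕ) (l : List ℕ) :
    oplusU U (d :: l) = pseudoSum (smulU d U) (oplusU U l) := by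
  cases l with
  | nil => simp only [oplusU, pseudoSum_pure_zero]
  | cons e l => rfl

theorem oplusU_append (U : Ultrafilter ℕ) (l₁ l₂ : List ℕ) :
    oplusU U (l₁ ++ l₂) = pseudoSum (oplusU U l₁) (oplusU U l₂) := by
  induction l₁ with
  | nil => simp only [oplusU, List.nil_append, pure_zero_pseudoSum]
  | cons d l ih => rw [List.cons_append, oplusU_cons, oplusU_cons, ih, pseudoSum_assoc]

theorem UEquiv.oplusU_eq {U : Ultrafilter ℕ} (hU : pseudoSum U U = U) {l₁ l₂ : List ℤ}
    (h : UEquiv l₁ l₂) : oplusU U (l₁.map Int.toNat) = oplusU U (l₂.map Int.toNat) := by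
  induction h with
  | nil_zero => simp [oplusU, smulU_zero]
  | dup a => simp [oplusU, ← smulU_pseudoSum, hU]
  | refl l => rfl
  | symm _ ih => exact ih.symm
  | trans _ _ ih₁ ih₂ => exact ih₁.trans ih₂
  | append _ _ ih₁ ih₂ => simp only [List.map_append, oplusU_append, ih₁, ih₂]

theorem UEquiv.forall_nonneg_iff {l₁ l₂ : List ℤ} (h : UEquiv l₁ l₂) :
    (∀ x ∈ l₁, 0 ≤ x) ↔ ∀ x ∈ l₂, 0 ≤ x := by
  induction h with
  | nil_zero => simp
  | dup a => simp
  | refl l => rfl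
  | symm _ ih => exact ih.symm
  | trans _ _ ih₁ ih₂ => exact ih₁.trans ih₂
  | append _ _ ih₁ ih₂ => simp only [List.forall_mem_append, ih₁, ih₂]

theorem uEquiv_coeffString (P : Polynomial ℤ) {N : ℕ} (hN : P.natDegree < N) :
    UEquiv (coeffString P) (List.ofFn fun j : Fin N => P.coeff j) := by
  induction N, Nat.succ_le_of_lt hN using Nat.le_induction with
  | base =>
    rw [coeffString, ← List.map_coe_finRange_eq_range, List.map_map, List.ofFn_eq_map]
    exact .refl _
  | succ N hN' ih =>
    refine (ih hN').trans ?_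
    rw [List.ofFn_succ_last]
    have h := UEquiv.append (.refl (List.ofFn fun j : Fin N => P.coeff j)) UEquiv.nil_zero
    simpa [Polynomial.coeff_eq_zero_of_natDegree_lt hN'] using h

/-- Finitely many sets belonging to linear combinations of the same ultrafilter contain the values
of the corresponding linear forms at a common point. -/
theorem exists_forall_sum_mem_of_mem_oplusU (U : Ultrafilter ℕ) {ι : Type*} [Finite ι] {N : ℕ}
    (f : ι → Fin N → ℕ) (A : ι → Set ℕ) (hA : ∀ i, A i ∈ oplusU U (List.ofFn (f i))) :
    ∃ y : Fin N → ℕ, ∀ i, ∑ j, y j * f i j ∈ A i := by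
  induction N generalizing A with
  | zero => exact ⟨Fin.elim0, fun i => by simpa [oplusU, Ultrafilter.mem_pure] using hA i⟩
  | succ N ih =>
    simp only [List.ofFn_succ, oplusU_cons, mem_pseudoSum, mem_smulU] at hA
    have hev : ∀ᶠ n in (U : Filter ℕ), ∀ i,
        {m | n * f i 0 + m ∈ A i} ∈ oplusU U (List.ofFn fun j => f i j.succ) :=
      Filter.eventually_all.2 hA
    obtain ⟨n, hn⟩ := hev.exists
    obtain ⟨y, hy⟩ := ih (fun i j => f i j.succ) _ hn
    exact ⟨Fin.cons n y, fun i => by simpa [Fin.sum_univ_succ] using hy i⟩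

/-- If `P₁, …, P_k ∈ ℤ[X]` are each `u`-equivalent to `∑ aᵢ Xⁱ` and
`c₁P₁ + … + c_kP_k = 0`, then for every idempotent ultrafilter `U` and every
`A ∈ a₀U ⊕ … ⊕ aₙU` there are `x₁, …, x_k ∈ A` with `c₁x₁ + … + c_kx_k = 0`. -/
theorem linear_pr (n k : ℕ) (a : Fin (n + 1) → ℕ) (c : Fin k → ℤ)
    (P : Fin k → Polynomial ℤ)
    (hP : ∀ i, PolyUEquiv (P i)
      (∑ j : Fin (n + 1), Polynomial.C ((a j : ℤ)) * Polynomial.X ^ (j : ℕ)))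
    (hlin : ∑ i, Polynomial.C (c i) * P i = 0)
    (U : Ultrafilter ℕ) (hU : IsIdempotentUF U)
    (A : Set ℕ) (hA : A ∈ oplusU U (List.ofFn a)) :
    ∃ x : Fin k → ℕ, (∀ i, x i ∈ A) ∧ ∑ i, c i * (x i : ℤ) = 0 := by
  set Q : Polynomial ℤ := ∑ j : Fin (n + 1), Polynomial.C ((a j : ℤ)) * Polynomial.X ^ (j : ℕ)
    with hQ
  have hQdeg : Q.natDegree < n + 1 := Nat.lt_succ_of_le <|
    Polynomial.natDegree_sum_le_of_forall_le _ _ fun j _ =>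
      (Polynomial.natDegree_C_mul_X_pow_le _ _).trans (Nat.le_of_lt_succ j.2)
  have hQcoeff : (List.ofFn fun j : Fin (n + 1) => Q.coeff j) = List.ofFn fun j => (a j : ℤ) := by
    congr 1
    ext j
    simp [hQ, Polynomial.finsetSum_coeff, Polynomial.coeff_X_pow, Fin.val_inj]
  obtain ⟨N, hN⟩ : ∃ N, ∀ i, (P i).natDegree < N :=
    ⟨Finset.univ.sup (fun i => (P i).natDegree) + 1, fun i => Nat.lt_succ_of_le <|
      Finset.le_sup (f := fun i => (P i).natDegree) (Finset.mem_univ i)⟩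
  have hequiv (i : Fin k) : UEquiv (List.ofFn fun j : Fin N => (P i).coeff j)
      (List.ofFn fun j => (a j : ℤ)) :=
    (uEquiv_coeffString (P i) (hN i)).symm.trans <|
      (hP i).trans (hQcoeff ▸ uEquiv_coeffString Q hQdeg)
  have hnonneg (i : Fin k) (j : Fin N) : 0 ≤ (P i).coeff j :=
    (hequiv i).forall_nonneg_iff.2 (by simp [List.mem_ofFn]) _ (by simp [List.mem_ofFn])
  obtain ⟨y, hy⟩ := exists_forall_sum_mem_of_mem_oplusU U
    (fun i (j : Fin N) => ((P i).coeff j).toNat) (fun _ => A) fun i => by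
      have h := (hequiv i).oplusU_eq hU.2
      simp only [List.map_ofFn, Function.comp_def, Int.toNat_natCast] at h
      exact h ▸ hA
  refine ⟨_, hy, ?_⟩
  have hcoeff (j : ℕ) : ∑ i, c i * (P i).coeff j = 0 := by
    simpa [Polynomial.finsetSum_coeff] using congrArg (Polynomial.coeff · j) hlin
  push_cast
  simp only [Int.toNat_of_nonneg (hnonneg _ _), Finset.mul_sum]
  rw [Finset.sum_comm]
  refine Finset.sum_eq_zero fun j _ => ?_
  calc ∑ i, c i * ((y j : ℤ) * (P i).coeff j) = y j * ∑ i, c i * (P i).coeff j := by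
        rw [Finset.mul_sum]
        exact Finset.sum_congr rfl fun i _ => by ring
    _ = 0 := by rw [hcoeff, mul_zero]
end

section
/- Let U be an idempotent ultrafilter on ℕ₀, and let a₀, …, a_k be positive integers. For every A ∈ a₀U ⊕ a₁U ⊕ … ⊕ a_kU there exists an infinite set of natural numbers X = {x₁ < x₂ < … < x_n < …} with the property that for every increasing sequence I₀ < I₁ < … < I_k of nonempty finite subsets of ℕ (i.e. max I_j < min I_{j+1} for all j < k), the sum Σ_{i∈I₀} a₀x_i + Σ_{i∈I₁} a₁x_i + … + Σ_{i∈I_k} a_kx_i belongs to A. -/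
open Ultrafilter Polynomial

open Filter in
/-- Along a filter finer than `atTop`, if each good state has finitely many successors, eventually
all good, then a strictly increasing sequence can be chosen that keeps every state reachable along
it good. -/
theorem exists_strictMono_forall_reachable {S : Type*} {L : Filter ℕ} [L.NeBot] (hL : L ≤ atTop)
    (Good : S → Prop) (next : S → ℕ → Set S) (hfin : ∀ s n, (next s n).Finite)
    (hnext : ∀ s, Good s → ∀ᶠ n in L, ∀ t ∈ next s n, Good t) (s₀ : S) (hs₀ : Good s₀) :
    ∃ (x : ℕ → ℕ) (F : ℕ → Set S), StrictMono x ∧ (∀ n, 0 < x n) ∧ s₀ ∈ F 0 ∧ Monotone F ∧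
      (∀ n, ∀ s ∈ F n, next s (x n) ⊆ F (n + 1)) ∧ ∀ n, ∀ s ∈ F n, Good s := by
  let T := {p : Set S × ℕ // p.1.Finite ∧ ∀ s ∈ p.1, Good s}
  have step (p : T) : ∃ q : T, p.1.1 ⊆ q.1.1 ∧ p.1.2 < q.1.2 ∧
      ∀ s ∈ p.1.1, next s q.1.2 ⊆ q.1.1 := by
    obtain ⟨⟨F, b⟩, hF, hgood⟩ := p
    obtain ⟨n, hn, hb⟩ := (((eventually_all_finite hF).2 fun s hs => hnext s (hgood s hs)).and
      (hL (eventually_gt_atTop b))).exists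
    refine ⟨⟨(F ∪ ⋃ s ∈ F, next s n, n), hF.union (hF.biUnion fun s _ => hfin s n), ?_⟩,
      Set.subset_union_left, hb, fun s hs =>
        (Set.subset_biUnion_of_mem (u := fun s => next s n) hs).trans Set.subset_union_right⟩
    rintro t (ht | ht)
    · exact hgood t ht
    · obtain ⟨s, hs, hst⟩ := Set.mem_iUnion₂.1 ht
      exact hn s hs t hst
  choose f hsub hlt hsucc using step
  let p₀ : T := ⟨({s₀}, 0), Set.finite_singleton s₀, by simpa using hs₀⟩
  let q : ℕ → T := fun n => f^[n] p₀
  have hq (n : ℕ) : q (n + 1) = f (q n) := Function.iterate_succ_apply' f n p₀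
  have hmono (n : ℕ) : (q n).1.2 < (q (n + 1)).1.2 := by rw [hq]; exact hlt _
  refine ⟨fun n => (q (n + 1)).1.2, fun n => (q n).1.1, strictMono_nat_of_lt_succ fun n =>
    hmono (n + 1), fun n => (Nat.zero_le _).trans_lt (hmono n), rfl,
    monotone_nat_of_le_succ fun n => ?_, fun n s hs => ?_, fun n => (q n).2.2⟩
  · rw [hq]; exact hsub _
  · simp only [hq]; exact hsucc _ s hs

open Filter in
theorem mem_oplusU_cons {U : Ultrafilter ℕ} {d : ℕ} {l : List ℕ} {B : Set ℕ} :
    B ∈ oplusU U (d :: l) ↔ ∀ᶠ n in U, {m | d * n + m ∈ B} ∈ oplusU U l := by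
  simp only [mul_comm d]
  cases l with
  | nil => exact Iff.rfl
  | cons e l => exact Iff.rfl

open Filter in
theorem IsIdempotentUF.le_atTop {U : Ultrafilter ℕ} (hU : IsIdempotentUF U) :
    (U : Filter ℕ) ≤ atTop := by
  rw [← Nat.cofinite_eq_atTop]
  refine U.le_cofinite_or_eq_pure.resolve_right ?_
  rintro ⟨n, hn⟩
  exact hU.1 n hn

open Filter in
theorem IsIdempotentUF.eventually_eventually_add {U : Ultrafilter ℕ} (hU : IsIdempotentUF U)
    {p : ℕ → Prop} (hp : ∀ᶠ n in U, p n) : ∀ᶠ n in U, ∀ᶠ m in U, p (n + m) := by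
  have h : {n | p n} ∈ pseudoSum U U := by rwa [hU.2]
  exact h

open Filter in
/-- After adding a term with the leading coefficient one may either move on to the remaining
coefficients or, by idempotency, keep the leading one. -/
theorem IsIdempotentUF.eventually_mem_oplusU {U : Ultrafilter ℕ} (hU : IsIdempotentUF U)
    {d : ℕ} {l : List ℕ} {B : Set ℕ} (hB : B ∈ oplusU U (d :: l)) :
    ∀ᶠ n in U, {m | d * n + m ∈ B} ∈ oplusU U (d :: l) ∧ {m | d * n + m ∈ B} ∈ oplusU U l := by
  rw [mem_oplusU_cons] at hB
  filter_upwards [hB, hU.eventually_eventually_add hB] with n h₁ h₂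
  refine ⟨mem_oplusU_cons.2 ?_, h₁⟩
  simpa only [Set.mem_ofPred_eq, mul_add, add_assoc] using h₂

/-- The states that can follow `(l, B)`, where `l` lists the coefficients still to be used and `B`
is the set in which the remaining sum should lie, after adding a term `n` with coefficient the head
of `l`. -/
def nextStates : List ℕ × Set ℕ → ℕ → Set (List ℕ × Set ℕ)
  | ([], _), _ => ∅
  | (d :: l, B), n => {(d :: l, {m | d * n + m ∈ B}), (l, {m | d * n + m ∈ B})}

theorem finite_nextStates (s : List ℕ × Set ℕ) (n : ℕ) : (nextStates s n).Finite := by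
  obtain ⟨_ | ⟨d, l⟩, B⟩ := s <;> simp [nextStates]

section Reachable

variable {x : ℕ → ℕ} {F : ℕ → Set (List ℕ × Set ℕ)}

theorem block_mem_of_nextStates_subset (hmono : Monotone F)
    (hnext : ∀ n, ∀ s ∈ F n, nextStates s (x n) ⊆ F (n + 1)) {d n : ℕ} {l : List ℕ} {B : Set ℕ}
    (hB : (d :: l, B) ∈ F n) (J : Finset ℕ) (hn : ∀ i ∈ J, n ≤ i) {N : ℕ} (hnN : n ≤ N)
    (hN : ∀ i ∈ J, i < N) :
    (d :: l, {m | ∑ i ∈ J, d * x i + m ∈ B}) ∈ F N ∧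
      (J.Nonempty → (l, {m | ∑ i ∈ J, d * x i + m ∈ B}) ∈ F N) := by
  induction J using Finset.induction_on_max generalizing N with
  | empty => simpa using hmono hnN hB
  | insert j J hj ih =>
    have hstate := (ih (fun i hi => hn i (Finset.mem_insert_of_mem hi))
      (hn j (Finset.mem_insert_self j J)) hj).1
    have hsub := (hnext j _ hstate).trans (hmono (hN j (Finset.mem_insert_self j J)))
    have heq : {m | ∑ i ∈ insert j J, d * x i + m ∈ B} =
        {m | d * x j + m ∈ {m | ∑ i ∈ J, d * x i + m ∈ B}} := by
      ext m
      rw [Finset.sum_insert fun h => (hj j h).false]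
      simp only [Set.mem_ofPred_eq, add_left_comm, add_assoc]
    rw [heq]
    exact ⟨hsub (Or.inl rfl), fun _ => hsub (Or.inr rfl)⟩

theorem sum_blocks_mem_of_nextStates_subset (hmono : Monotone F)
    (hnext : ∀ n, ∀ s ∈ F n, nextStates s (x n) ⊆ F (n + 1))
    (hgood : ∀ n B, ([], B) ∈ F n → 0 ∈ B) (k : ℕ) (a : Fin (k + 1) → ℕ) {n : ℕ} {B : Set ℕ}
    (hB : (List.ofFn a, B) ∈ F n) (I : Fin (k + 1) → Finset ℕ) (hI : ∀ s, (I s).Nonempty)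
    (hlt : ∀ s : Fin k, ∀ i ∈ I s.castSucc, ∀ j ∈ I s.succ, i < j) (hn : ∀ i ∈ I 0, n ≤ i) :
    ∑ s, ∑ i ∈ I s, a s * x i ∈ B := by
  have hmax (i : ℕ) (hi : i ∈ I 0) : i < (I 0).max' (hI 0) + 1 :=
    Nat.lt_succ_of_le ((I 0).le_max' i hi)
  induction k generalizing n B with
  | zero =>
    rw [List.ofFn_succ] at hB
    have hmem := (block_mem_of_nextStates_subset hmono hnext hB (I 0) hn
      ((hn _ ((I 0).max'_mem (hI 0))).trans (Nat.le_succ _)) hmax).2 (hI 0)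
    have hzero := hgood _ _ (by simpa using hmem)
    simpa [Set.mem_ofPred_eq] using hzero
  | succ k ih =>
    rw [List.ofFn_succ] at hB
    have hmem := (block_mem_of_nextStates_subset hmono hnext hB (I 0) hn
      ((hn _ ((I 0).max'_mem (hI 0))).trans (Nat.le_succ _)) hmax).2 (hI 0)
    rw [Fin.sum_univ_succ]
    exact ih (fun s => a s.succ) hmem (fun s => I s.succ) (fun s => hI s.succ)
      (fun s => hlt s.succ) (fun j hj => hlt 0 _ ((I 0).max'_mem (hI 0)) j hj)
      fun i hi => Nat.lt_succ_of_le (Finset.le_max' _ i hi)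

end Reachable

/-- For an idempotent ultrafilter `U`, positive integers `a₀, …, a_k`, and
`A ∈ a₀U ⊕ … ⊕ a_kU`, there is an infinite set `X = {x₁ < x₂ < …}` of positive
integers such that for every increasing sequence `I₀ < … < I_k` of nonempty
finite sets of indices, `∑_{i∈I₀} a₀xᵢ + … + ∑_{i∈I_k} a_kxᵢ ∈ A`. -/
theorem millikenTaylor_lemma (k : ℕ) (U : Ultrafilter ℕ) (hU : IsIdempotentUF U)
    (a : Fin (k + 1) → ℕ) (ha : ∀ s, 0 < a s)
    (A : Set ℕ) (hA : A ∈ oplusU U (List.ofFn a)) :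
    ∃ x : ℕ → ℕ, StrictMono x ∧ (∀ n, 0 < x n) ∧
      ∀ I : Fin (k + 1) → Finset ℕ, (∀ s, (I s).Nonempty) →
        (∀ s : Fin k, ∀ i ∈ I s.castSucc, ∀ j ∈ I s.succ, i < j) →
        (∑ s, ∑ i ∈ I s, a s * x i) ∈ A := by
  have hmem (s : List ℕ × Set ℕ) (hs : s.2 ∈ oplusU U s.1) :
      ∀ᶠ n in (U : Filter ℕ), ∀ t ∈ nextStates s n, t.2 ∈ oplusU U t.1 := by
    obtain ⟨_ | ⟨d, l⟩, B⟩ := s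
    · simp [nextStates]
    · simpa [nextStates] using hU.eventually_mem_oplusU hs
  obtain ⟨x, F, hx, hpos, h₀, hmono, hnext, hgood⟩ :=
    exists_strictMono_forall_reachable hU.le_atTop (fun s : List ℕ × Set ℕ => s.2 ∈ oplusU U s.1)
      nextStates finite_nextStates hmem (List.ofFn a, A) hA
  exact ⟨x, hx, hpos, fun I hI hlt => sum_blocks_mem_of_nextStates_subset hmono hnext
    (fun n B hB => hgood n _ hB) k a h₀ I hI hlt fun i _ => i.zero_le⟩
end

section
/- (Milliken–Taylor) Let a finite coloring ℕ = C₁ ⊔ … ⊔ C_r be given. For every choice of positive integers a₀, …, a_k there exists an infinite set X = {x₁ < x₂ < … < x_n < x_{n+1} < …} ⊆ ℕ and a color C_j such that for every increasing sequence I₀ < I₁ < … < I_k of nonempty finite subsets of ℕ (i.e. max I_s < min I_{s+1} for all s < k), the sum Σ_{i∈I₀} a₀x_i + Σ_{i∈I₁} a₁x_i + … + Σ_{i∈I_k} a_kx_i belongs to C_j. -/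
open Filter

namespace MillikenTaylor

/-- There is an additively idempotent ultrafilter on the positive integers. -/
theorem exists_idempotent_ultrafilter :
    ∃ U : Ultrafilter ℕ+, ∀ p : ℕ+ → Prop,
      (∀ᶠ m in U, p m) ↔ ∀ᶠ m in U, ∀ᶠ m' in U, p (m + m') := by
  let _ : AddSemigroup (Ultrafilter ℕ+) := Ultrafilter.addSemigroup
  obtain ⟨U, hU⟩ := exists_idempotent_of_compact_t2_of_continuous_add_left
    (@Ultrafilter.continuous_add_left ℕ+ _)
  refine ⟨U, fun p => ?_⟩
  rw [← Ultrafilter.eventually_add]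
  exact Iff.of_eq (congrArg (fun V : Ultrafilter ℕ+ => ∀ᶠ m in V, p m) hU.symm)

theorem eventually_gt_of_idempotent {U : Ultrafilter ℕ+}
    (hU : ∀ p : ℕ+ → Prop, (∀ᶠ m in U, p m) ↔ ∀ᶠ m in U, ∀ᶠ m' in U, p (m + m'))
    (n : ℕ) : ∀ᶠ m : ℕ+ in U, n < (m : ℕ) := by
  induction n with
  | zero => exact Eventually.of_forall fun m => m.pos
  | succ n ih =>
    rw [hU]
    refine Eventually.of_forall fun m => ih.mono fun m' hm' => ?_
    have := m.pos
    rw [PNat.add_coe]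
    omega

/-- `Largely U A l y` says that for `U`-most `m₁`, for `U`-most `m₂`, and so on,
`y + c₁ * m₁ + c₂ * m₂ + ⋯` lies in `A`, where `l = [c₁, c₂, …]`. -/
def Largely (U : Ultrafilter ℕ+) (A : Set ℕ) : List ℕ → ℕ → Prop
  | [], y => y ∈ A
  | c :: l, y => ∀ᶠ m : ℕ+ in U, Largely U A l (y + c * (m : ℕ))

theorem exists_largely {ι : Type*} [Finite ι] (U : Ultrafilter ℕ+) (C : ℕ → ι) (l : List ℕ)
    (y : ℕ) : ∃ j, Largely U (C ⁻¹' {j}) l y := by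
  induction l generalizing y with
  | nil => exact ⟨C y, rfl⟩
  | cons c l ih =>
    exact Ultrafilter.eventually_exists_iff.1 (Eventually.of_forall fun m : ℕ+ => ih (y + c * m))

/-- The successor of the state `q` when `m` is used, as the last term of its block or not. -/
def next (m : ℕ+) (last : Bool) (q : List ℕ × ℕ) : List ℕ × ℕ :=
  (if last then q.1.tail else q.1, q.2 + q.1.headD 0 * m)

theorem eventually_largely_next {U : Ultrafilter ℕ+}
    (hU : ∀ p : ℕ+ → Prop, (∀ᶠ m in U, p m) ↔ ∀ᶠ m in U, ∀ᶠ m' in U, p (m + m'))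
    {A : Set ℕ} {q : List ℕ × ℕ} (hq : Largely U A q.1 q.2) (last : Bool) :
    ∀ᶠ m in U, Largely U A (next m last q).1 (next m last q).2 := by
  obtain ⟨_ | ⟨c, l⟩, y⟩ := q
  · cases last <;> simpa [next] using hq
  · cases last
    · have h := (hU fun m => Largely U A l (y + c * (m : ℕ))).1 hq
      simpa [next, Largely, mul_add, add_assoc] using h
    · simpa [next, Largely] using hq

/-- All states reachable from a state in `S` by using `m` at most once. -/
def step (m : ℕ+) (S : Finset (List ℕ × ℕ)) : Finset (List ℕ × ℕ) :=
  S ∪ (S.image (next m true) ∪ S.image (next m false))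

theorem next_mem_step {m : ℕ+} {S : Finset (List ℕ × ℕ)} {q : List ℕ × ℕ} (hq : q ∈ S)
    (last : Bool) : next m last q ∈ step m S := by
  cases last
  · exact Finset.mem_union_right _ (Finset.mem_union_right _ (Finset.mem_image_of_mem _ hq))
  · exact Finset.mem_union_right _ (Finset.mem_union_left _ (Finset.mem_image_of_mem _ hq))

theorem exists_step {U : Ultrafilter ℕ+}
    (hU : ∀ p : ℕ+ → Prop, (∀ᶠ m in U, p m) ↔ ∀ᶠ m in U, ∀ᶠ m' in U, p (m + m'))
    {A : Set ℕ} {S : Finset (List ℕ × ℕ)} (hS : ∀ q ∈ S, Largely U A q.1 q.2) (n : ℕ+) :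
    ∃ m : ℕ+, n < m ∧ ∀ q ∈ step m S, Largely U A q.1 q.2 := by
  have h : ∀ᶠ m in U, ∀ q ∈ S, ∀ last,
      Largely U A (next m last q).1 (next m last q).2 :=
    (eventually_all_finset S).2 fun q hq =>
      eventually_all.2 fun last => eventually_largely_next hU (hS q hq) last
  obtain ⟨m, hm, hnm⟩ := (h.and (eventually_gt_of_idempotent hU n)).exists
  refine ⟨m, hnm, fun q hq => ?_⟩
  simp only [step, Finset.mem_union, Finset.mem_image] at hq
  obtain hq | ⟨q, hq, rfl⟩ | ⟨q, hq, rfl⟩ := hq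
  exacts [hS q hq, hm q hq true, hm q hq false]

theorem exists_sequence {U : Ultrafilter ℕ+}
    (hU : ∀ p : ℕ+ → Prop, (∀ᶠ m in U, p m) ↔ ∀ᶠ m in U, ∀ᶠ m' in U, p (m + m'))
    {A : Set ℕ} {q₀ : List ℕ × ℕ} (h₀ : Largely U A q₀.1 q₀.2) :
    ∃ (x : ℕ → ℕ+) (S : ℕ → Finset (List ℕ × ℕ)), StrictMono x ∧ q₀ ∈ S 0 ∧
      (∀ n, S (n + 1) = step (x n) (S n)) ∧ ∀ n, ∀ q ∈ S n, Largely U A q.1 q.2 := by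
  let State := {p : ℕ+ × Finset (List ℕ × ℕ) // ∀ q ∈ p.2, Largely U A q.1 q.2}
  choose m hlt hm using fun p : State => exists_step hU p.2 p.1.1
  let start : State := ⟨(1, {q₀}), by simpa using h₀⟩
  let f : ℕ → State := fun n => (fun p : State => ⟨(m p, step (m p) p.1.2), hm p⟩)^[n] start
  have hf (n : ℕ) : f (n + 1) = ⟨(m (f n), step (m (f n)) (f n).1.2), hm (f n)⟩ :=
    Function.iterate_succ_apply' _ _ _
  refine ⟨fun n => m (f n), fun n => (f n).1.2, strictMono_nat_of_lt_succ fun n => ?_,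
    Finset.mem_singleton_self q₀, fun n => by simp only [hf], fun n => (f n).2⟩
  have h := hlt (f (n + 1))
  rwa [show (f (n + 1)).1.1 = m (f n) by rw [hf]] at h

section Reachable

variable {x : ℕ → ℕ+} {S : ℕ → Finset (List ℕ × ℕ)}

theorem monotone_of_eq_step (hS : ∀ n, S (n + 1) = step (x n) (S n)) : Monotone S :=
  monotone_nat_of_le_succ fun n => by
    rw [hS]
    exact Finset.subset_union_left

theorem mem_after_block (hS : ∀ n, S (n + 1) = step (x n) (S n)) {c : ℕ} {l : List ℕ}
    (I : Finset ℕ) (hI : I.Nonempty) {y n N : ℕ} (hy : (c :: l, y) ∈ S n)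
    (hn : ∀ i ∈ I, n ≤ i) (hN : ∀ i ∈ I, i < N) :
    (l, y + ∑ i ∈ I, c * (x i : ℕ)) ∈ S N := by
  induction I using Finset.induction_on_min generalizing y n with
  | empty => exact absurd hI Finset.not_nonempty_empty
  | insert i I hlt ih =>
    have hy' : (c :: l, y) ∈ S i :=
      monotone_of_eq_step hS (hn i (Finset.mem_insert_self i I)) hy
    have hmem (last : Bool) : next (x i) last (c :: l, y) ∈ S (i + 1) := by
      rw [hS]
      exact next_mem_step hy' last
    rw [Finset.sum_insert fun h => (hlt i h).false, ← add_assoc]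
    obtain rfl | hne := I.eq_empty_or_nonempty
    · exact monotone_of_eq_step hS (hN i (Finset.mem_insert_self i _))
        (by simpa [next] using hmem true)
    · exact ih hne (by simpa [next] using hmem false) hlt
        fun j hj => hN j (Finset.mem_insert_of_mem hj)

theorem exists_mem_after_blocks (hS : ∀ n, S (n + 1) = step (x n) (S n)) (k : ℕ)
    (a : Fin (k + 1) → ℕ) (I : Fin (k + 1) → Finset ℕ) (hI : ∀ s, (I s).Nonempty)
    (hlt : ∀ s : Fin k, ∀ i ∈ I s.castSucc, ∀ i' ∈ I s.succ, i < i')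
    {y n : ℕ} (hy : (List.ofFn a, y) ∈ S n) (hn : ∀ i ∈ I 0, n ≤ i) :
    ∃ N, ([], y + ∑ s, ∑ i ∈ I s, a s * (x i : ℕ)) ∈ S N := by
  induction k generalizing y n with
  | zero =>
    rw [List.ofFn_succ] at hy
    refine ⟨(I 0).sup id + 1, ?_⟩
    simpa using mem_after_block hS (I 0) (hI 0) hy hn
      fun i hi => Nat.lt_succ_of_le (Finset.le_sup (f := id) hi)
  | succ k ih =>
    have hN : ∀ i ∈ I 0, i < (I 0).sup id + 1 :=
      fun i hi => Nat.lt_succ_of_le (Finset.le_sup (f := id) hi)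
    have hn' : ∀ i ∈ I (Fin.succ 0), (I 0).sup id + 1 ≤ i := by
      intro i hi
      rw [Nat.succ_le_iff]
      obtain ⟨j, hj, hsup⟩ := Finset.exists_mem_eq_sup (I 0) (hI 0) id
      rw [hsup]
      exact hlt 0 j hj i hi
    rw [Fin.sum_univ_succ, ← add_assoc]
    rw [List.ofFn_succ] at hy
    exact ih (fun s => a s.succ) (fun s => I s.succ) (fun s => hI _) (fun s => hlt s.succ)
      (mem_after_block hS (I 0) (hI 0) hy hn hN) hn'

end Reachable

end MillikenTaylor

open MillikenTaylor in
/-- Milliken–Taylor theorem: for every finite coloring of the positive integers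
and every choice of positive integers `a₀, …, a_k`, there is an infinite set
`X = {x₁ < x₂ < …}` of positive integers and a color `j` such that all the sums
`∑_{i∈I₀} a₀xᵢ + … + ∑_{i∈I_k} a_kxᵢ`, for increasing sequences `I₀ < … < I_k`
of nonempty finite sets of indices, have color `j`. -/
theorem millikenTaylor (r k : ℕ) (C : ℕ → Fin r)
    (a : Fin (k + 1) → ℕ) (ha : ∀ s, 0 < a s) :
    ∃ x : ℕ → ℕ, StrictMono x ∧ (∀ n, 0 < x n) ∧ ∃ j : Fin r,
      ∀ I : Fin (k + 1) → Finset ℕ, (∀ s, (I s).Nonempty) →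
        (∀ s : Fin k, ∀ i ∈ I s.castSucc, ∀ i' ∈ I s.succ, i < i') →
        C (∑ s, ∑ i ∈ I s, a s * x i) = j := by
  obtain ⟨U, hU⟩ := exists_idempotent_ultrafilter
  obtain ⟨j, hj⟩ := exists_largely U C (List.ofFn a) 0
  obtain ⟨x, S, hx, h₀, hS, hlargely⟩ := exists_sequence hU (q₀ := (List.ofFn a, 0)) hj
  refine ⟨fun n => x n, fun m n hmn => hx hmn, fun n => (x n).pos, j, fun I hI hlt => ?_⟩
  obtain ⟨N, hN⟩ := exists_mem_after_blocks hS k a I hI hlt h₀ fun i _ => i.zero_le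
  simpa [Largely] using hlargely N _ hN
end

section
/- Let k > 2 and let c₁ ≥ c₂ ≥ … ≥ c_k be integers, not all zero, with c₁ + c₂ + … + c_k = 0. Define a₀ = c₁·(c₁+c₂)·…·(c₁+…+c_{k−2}); for each i with 0 < i < k−2, define a_i = b_i·b'_i where b_i = c₁·(c₁+c₂)·…·(c₁+…+c_{k−2−i}) and b'_i = (−1)^i·c_k·(c_k+c_{k−1})·…·(c_k+c_{k−1}+…+c_{k+1−i}); and define a_{k−2} = (−1)^{k−2}·c_k·(c_k+c_{k−1})·…·(c_k+…+c₃). Then a_i > 0 for every i with 0 ≤ i ≤ k−2, and for every j with 1 ≤ j ≤ k−2 one has (c₁ + … + c_{k−1−j})·a_j + (c_{k−j+1} + … + c_k)·a_{j−1} = 0. -/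
open Finset in
/-- Splitting a sum over `Icc 1 k` at `m`. -/
theorem sum_Icc_one_add_sum_Icc (c : ℕ → ℤ) {m k : ℕ} (hm : m ≤ k) :
    ∑ i ∈ Icc 1 m, c i + ∑ i ∈ Icc (m + 1) k, c i = ∑ i ∈ Icc 1 k, c i := by
  rw [← sum_union]
  · congr 1
    ext i
    simp only [mem_union, mem_Icc]
    omega
  · rw [disjoint_left]
    intro i
    simp only [mem_Icc]
    omega

open Finset in
/-- The proper partial sums of a nonzero non-increasing string with sum zero are positive. -/
theorem sum_Icc_one_pos_of_antitone {k : ℕ} {c : ℕ → ℤ}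
    (hmono : ∀ i j, 1 ≤ i → i ≤ j → j ≤ k → c j ≤ c i)
    (hne : ∃ i, 1 ≤ i ∧ i ≤ k ∧ c i ≠ 0)
    (hsum : ∑ i ∈ Icc 1 k, c i = 0) {m : ℕ} (hm : 1 ≤ m) (hmk : m < k) :
    0 < ∑ i ∈ Icc 1 m, c i := by
  by_contra! hS
  have hsplit := sum_Icc_one_add_sum_Icc c hmk.le
  have hcm : c m ≤ 0 := by
    by_contra! h
    refine hS.not_gt (sum_pos (fun i hi => ?_) ⟨m, by simp [hm]⟩)
    rw [mem_Icc] at hi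
    exact h.trans_le (hmono i m hi.1 hi.2 hmk.le)
  have hcm' : 0 ≤ c (m + 1) := by
    by_contra! h
    have : ∑ i ∈ Icc (m + 1) k, c i < 0 := by
      refine sum_neg (fun i hi => ?_) ⟨m + 1, by simp; omega⟩
      rw [mem_Icc] at hi
      exact (hmono (m + 1) i (by omega) hi.1 hi.2).trans_lt h
    linarith
  have hle := hmono m (m + 1) hm (by omega) hmk
  have hhead : ∀ i ∈ Icc 1 m, 0 ≤ c i := fun i hi => by
    rw [mem_Icc] at hi
    linarith [hmono i m hi.1 hi.2 hmk.le]
  have htail : ∀ i ∈ Icc (m + 1) k, c i ≤ 0 := fun i hi => by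
    rw [mem_Icc] at hi
    linarith [hmono (m + 1) i (by omega) hi.1 hi.2]
  have hhead_sum := sum_nonneg hhead
  have hzero_head := (sum_eq_zero_iff_of_nonneg hhead).1 (by linarith)
  have hzero_tail := (sum_eq_zero_iff_of_nonpos htail).1 (by linarith)
  obtain ⟨i, hi1, hik, hi⟩ := hne
  rcases le_or_gt i m with h | h
  · exact hi (hzero_head i (mem_Icc.2 ⟨hi1, h⟩))
  · exact hi (hzero_tail i (mem_Icc.2 ⟨h, hik⟩))


/-- The explicit coefficients `a₀, …, a_{k-2}` built from a non-increasing
integer string `c₁ ≥ … ≥ c_k`, not all zero, with `c₁ + … + c_k = 0`, are all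
positive and satisfy the system `(c₁+…+c_{k-1-j})·a_j + (c_{k-j+1}+…+c_k)·a_{j-1} = 0`. -/
theorem rado_coefficients (k : ℕ) (hk : 2 < k) (c : ℕ → ℤ)
    (hmono : ∀ i j, 1 ≤ i → i ≤ j → j ≤ k → c j ≤ c i)
    (hne : ∃ i, 1 ≤ i ∧ i ≤ k ∧ c i ≠ 0)
    (hsum : ∑ i ∈ Finset.Icc 1 k, c i = 0)
    (a : ℕ → ℤ)
    (ha0 : a 0 = ∏ m ∈ Finset.Icc 1 (k - 2), ∑ j ∈ Finset.Icc 1 m, c j)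
    (hai : ∀ i, 0 < i → i < k - 2 →
      a i = (∏ m ∈ Finset.Icc 1 (k - 2 - i), ∑ j ∈ Finset.Icc 1 m, c j) *
        ((-1 : ℤ) ^ i * ∏ m ∈ Finset.Icc 1 i, ∑ j ∈ Finset.Icc (k + 1 - m) k, c j))
    (hak : a (k - 2) =
      (-1 : ℤ) ^ (k - 2) * ∏ m ∈ Finset.Icc 1 (k - 2), ∑ j ∈ Finset.Icc (k + 1 - m) k, c j) :
    (∀ i ≤ k - 2, 0 < a i) ∧
      ∀ j, 1 ≤ j → j ≤ k - 2 →
        (∑ m ∈ Finset.Icc 1 (k - 1 - j), c m) * a j +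
          (∑ m ∈ Finset.Icc (k - j + 1) k, c m) * a (j - 1) = 0 := by
  have hform : ∀ i ≤ k - 2,
      a i = (∏ m ∈ Finset.Icc 1 (k - 2 - i), ∑ j ∈ Finset.Icc 1 m, c j) *
        ((-1 : ℤ) ^ i * ∏ m ∈ Finset.Icc 1 i, ∑ j ∈ Finset.Icc (k + 1 - m) k, c j) := by
    intro i hi
    rcases Nat.eq_zero_or_pos i with rfl | h0
    · simp [ha0]
    · rcases hi.lt_or_eq with h | rfl
      · exact hai i h0 h
      · simp [hak]
  refine ⟨fun i hi => ?_, fun j hj1 hj => ?_⟩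
  · rw [hform i hi]
    refine mul_pos (Finset.prod_pos fun m hm => ?_) ?_
    · rw [Finset.mem_Icc] at hm
      exact sum_Icc_one_pos_of_antitone hmono hne hsum hm.1 (by omega)
    · have hneg : (-1 : ℤ) ^ i * ∏ m ∈ Finset.Icc 1 i, ∑ j ∈ Finset.Icc (k + 1 - m) k, c j =
          ∏ m ∈ Finset.Icc 1 i, -∑ j ∈ Finset.Icc (k + 1 - m) k, c j := by
        rw [Finset.prod_neg]
        simp
      rw [hneg]
      refine Finset.prod_pos fun m hm => ?_
      rw [Finset.mem_Icc] at hm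
      have hpos := sum_Icc_one_pos_of_antitone (m := k - m) hmono hne hsum (by omega) (by omega)
      have hsplit := sum_Icc_one_add_sum_Icc c (Nat.sub_le k m)
      rw [show k - m + 1 = k + 1 - m by omega] at hsplit
      linarith
  · obtain ⟨n, rfl⟩ : ∃ n, j = n + 1 := ⟨j - 1, by omega⟩
    rw [hform _ hj, Nat.add_sub_cancel, hform n (by omega),
      show k - 2 - n = k - 2 - (n + 1) + 1 by omega,
      show k - 1 - (n + 1) = k - 2 - (n + 1) + 1 by omega,
      show k - (n + 1) + 1 = k + 1 - (n + 1) by omega,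
      Finset.prod_Icc_succ_top (by omega), Finset.prod_Icc_succ_top (by omega)]
    ring
end
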